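/- arXiv:2510.26290 — 2 statements merged into one kernel-verified Lean document; each statement's English description precedes it below -/
import Mathlib

section
/- Let p ∈ [0,1] and let ρ_noise(p) be the noisy GHZ state on three qubits. Then the partial transpose of ρ_noise(p) with respect to the third qubit, defined entrywise by ρ^{T₃}((i,j,k),(l,m,n)) = ρ_noise(p)((i,j,n),(l,m,k)), is positive semidefinite if and only if p ≤ 1/5. -/
open Matrix BigOperators ComplexOrder

noncomputable section

/-- The rank-one matrix `x x†`. -/
def rankOne {n : Type*} (x : n → ℂ) : Matrix n n ℂ :=
  Matrix.of fun i j => x i * (starRingEnd ℂ) (x j)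

/-- The GHZ vector `(|000⟩ + |111⟩)/√2`. -/
def Gplus : (Fin 2 × Fin 2 × Fin 2) → ℂ := fun x =>
  ((if x = (0, 0, 0) then 1 else 0) + (if x = (1, 1, 1) then 1 else 0)) / (Real.sqrt 2 : ℂ)

/-- The noisy GHZ state `p |G⁺⟩⟨G⁺| + (1-p)/8 · I₈`. -/
def rhoNoise (p : ℝ) :
    Matrix (Fin 2 × Fin 2 × Fin 2) (Fin 2 × Fin 2 × Fin 2) ℂ :=
  (p : ℂ) • rankOne Gplus + (((1 - p) / 8 : ℝ) : ℂ) • 1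

/-- Partial transpose on the third qubit. -/
def pt3 (M : Matrix (Fin 2 × Fin 2 × Fin 2) (Fin 2 × Fin 2 × Fin 2) ℂ) :
    Matrix (Fin 2 × Fin 2 × Fin 2) (Fin 2 × Fin 2 × Fin 2) ℂ :=
  Matrix.of fun x y => M (x.1, x.2.1, y.2.2) (y.1, y.2.1, x.2.2)

lemma Gplus_mul_conj (x y : Fin 2 × Fin 2 × Fin 2) :
    Gplus x * (starRingEnd ℂ) (Gplus y) =
      (if (x = (0, 0, 0) ∨ x = (1, 1, 1)) ∧ (y = (0, 0, 0) ∨ y = (1, 1, 1)) then 1 / 2 else 0) := by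
  have h : (Real.sqrt 2 : ℂ) * (Real.sqrt 2 : ℂ) = 2 := by
    rw [← Complex.ofReal_mul, Real.mul_self_sqrt (by norm_num)]
    norm_num
  have h' : (Real.sqrt 2 : ℂ)⁻¹ * (Real.sqrt 2 : ℂ)⁻¹ = 2⁻¹ := by
    rw [← mul_inv, h]
  obtain ⟨a, b, c⟩ := x
  obtain ⟨d, e, f⟩ := y
  fin_cases a <;> fin_cases b <;> fin_cases c <;> fin_cases d <;> fin_cases e <;> fin_cases f <;>
    simp [Gplus, h']

/-- The vector `|001⟩ + s |110⟩`. -/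
def flipVec (s : ℂ) : (Fin 2 × Fin 2 × Fin 2) → ℂ := fun x =>
  (if x = (0, 0, 1) then 1 else 0) + (if x = (1, 1, 0) then s else 0)

/-- The diagonal remaining after `p / 2` times the projector on `|001⟩ + |110⟩` is removed
from the partially transposed noisy GHZ state. -/
def ptDiag (p : ℝ) : (Fin 2 × Fin 2 × Fin 2) → ℝ := fun x =>
  if x = (0, 0, 0) ∨ x = (1, 1, 1) then (1 + 3 * p) / 8
  else if x = (0, 0, 1) ∨ x = (1, 1, 0) then (1 - 5 * p) / 8 else (1 - p) / 8

lemma pt3_rhoNoise_eq (p : ℝ) :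
    pt3 (rhoNoise p) = ((p / 2 : ℝ) : ℂ) • vecMulVec (flipVec 1) (star (flipVec 1)) +
      diagonal fun x => (ptDiag p x : ℂ) := by
  ext ⟨a, b, c⟩ ⟨d, e, f⟩
  simp only [pt3, rhoNoise, rankOne, Matrix.of_apply, Matrix.add_apply, Matrix.smul_apply,
    Gplus_mul_conj, vecMulVec_apply, Pi.star_apply, diagonal_apply, Matrix.one_apply]
  fin_cases a <;> fin_cases b <;> fin_cases c <;> fin_cases d <;> fin_cases e <;> fin_cases f <;>
    simp [flipVec, ptDiag] <;> ring

/-- The partial transpose of the noisy GHZ state with respect to the third qubit is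
positive semidefinite iff `p ≤ 1/5`. -/
theorem pt3_noisy_ghz_posSemidef_iff (p : ℝ) (hp0 : 0 ≤ p) (hp1 : p ≤ 1) :
    (pt3 (rhoNoise p)).PosSemidef ↔ p ≤ 1 / 5 := by
  rw [pt3_rhoNoise_eq]
  constructor
  · intro h
    have key := h.dotProduct_mulVec_nonneg (flipVec (-1))
    have hval : star (flipVec (-1)) ⬝ᵥ ((((p / 2 : ℝ) : ℂ) •
        vecMulVec (flipVec 1) (star (flipVec 1)) +
          diagonal fun x => (ptDiag p x : ℂ)) *ᵥ flipVec (-1)) = (((1 - 5 * p) / 4 : ℝ) : ℂ) := by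
      simp [dotProduct, mulVec, vecMulVec_apply, diagonal_apply,
        Fintype.sum_prod_type, flipVec, ptDiag]
      ring
    rw [hval, Complex.zero_le_real] at key
    linarith
  · intro h
    refine ((posSemidef_vecMulVec_self_star _).smul ?_).add (PosSemidef.diagonal fun x => ?_)
    · exact Complex.zero_le_real.mpr (by linarith)
    · refine Complex.zero_le_real.mpr ?_
      unfold ptDiag
      split_ifs <;> linarith
end
end

section
/- Let p ∈ [0,1] and let V = (8p²/3)·w w† + (3(1−p)²/8)·I₄ + 2p(1−p)·(|00⟩⟨00| + |11⟩⟨11|) with w = |00⟩ + |11⟩ (the unnormalized state obtained from the distilled noisy W state by projecting one qubit onto |0⟩ and applying Pauli-X to one remaining qubit). Then the partial transpose V^{T₂} is positive semidefinite if and only if p ≤ 3/11. (Hence distillation does not lower the localizable-entanglement threshold of the noisy W state: both before and after distillation the threshold is p = 3/11.) -/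
open Matrix BigOperators ComplexOrder

noncomputable section

/-- The unnormalized vector `|00⟩ + |11⟩`. -/
def wVec : Fin 2 × Fin 2 → ℂ := fun x =>
  (if x = (0, 0) then 1 else 0) + (if x = (1, 1) then 1 else 0)

/-- The standard basis vector of ℂ⁴. -/
def basis2 (t : Fin 2 × Fin 2) : Fin 2 × Fin 2 → ℂ :=
  fun x => if x = t then 1 else 0

/-- Partial transpose on the second factor of a bipartite matrix. -/
def pt2 {a b : ℕ} (M : Matrix (Fin a × Fin b) (Fin a × Fin b) ℂ) :
    Matrix (Fin a × Fin b) (Fin a × Fin b) ℂ :=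
  Matrix.of fun p q => M (p.1, q.2) (q.1, p.2)

lemma rankOne_posSemidef {n : Type*} [Fintype n] (x : n → ℂ) : (rankOne x).PosSemidef :=
  Matrix.posSemidef_vecMulVec_self_star x

/-- The partial transpose of `a w w† + c I₄ + d (|00⟩⟨00| + |11⟩⟨11|)` has the diagonal
entries `a + c + d` at `|00⟩, |11⟩` and the block `a 𝟙𝟙† + (c - a) I₂` on `|01⟩, |10⟩`. -/
lemma pt2_rankOne_wVec_add (a c d : ℂ) :
    pt2 (a • rankOne wVec + c • 1
        + d • (rankOne (basis2 (0, 0)) + rankOne (basis2 (1, 1))))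
      = (a + c + d) • (rankOne (basis2 (0, 0)) + rankOne (basis2 (1, 1)))
        + a • rankOne (basis2 (0, 1) + basis2 (1, 0))
        + (c - a) • (rankOne (basis2 (0, 1)) + rankOne (basis2 (1, 0))) := by
  ext ⟨i, j⟩ ⟨k, l⟩
  fin_cases i <;> fin_cases j <;> fin_cases k <;> fin_cases l <;>
    simp [pt2, rankOne, wVec, basis2, Matrix.one_apply]

lemma pt2_rankOne_wVec_add_posSemidef_iff {a c d : ℝ} (ha : 0 ≤ a) (hc : 0 ≤ c) (hd : 0 ≤ d) :
    (pt2 ((a : ℂ) • rankOne wVec + (c : ℂ) • 1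
        + (d : ℂ) • (rankOne (basis2 (0, 0)) + rankOne (basis2 (1, 1))))).PosSemidef
      ↔ a ≤ c := by
  rw [pt2_rankOne_wVec_add]
  constructor
  · intro h
    have h2 := h.dotProduct_mulVec_nonneg (basis2 (0, 1) - basis2 (1, 0))
    simp [dotProduct, mulVec, Fintype.sum_prod_type, rankOne, basis2] at h2
    norm_cast at h2
    linarith
  · intro h
    have hs : (0 : ℂ) ≤ (a : ℂ) + c + d := by exact_mod_cast add_nonneg (add_nonneg ha hc) hd
    have hac : (0 : ℂ) ≤ (c : ℂ) - a := by exact_mod_cast sub_nonneg.2 h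
    exact ((((rankOne_posSemidef _).add (rankOne_posSemidef _)).smul hs).add
      ((rankOne_posSemidef _).smul (by exact_mod_cast ha))).add
      (((rankOne_posSemidef _).add (rankOne_posSemidef _)).smul hac)

/-- For the unnormalized state obtained from the distilled noisy W state by projecting
one qubit onto `|0⟩` and applying Pauli-X to one remaining qubit,
`V = (8p²/3) w w† + (3(1-p)²/8) I₄ + 2p(1-p)(|00⟩⟨00| + |11⟩⟨11|)` with
`w = |00⟩ + |11⟩`, the partial transpose is positive semidefinite iff `p ≤ 3/11`. -/
theorem pt_distilled_localized_noisy_w_posSemidef_iff (p : ℝ) (hp0 : 0 ≤ p) (hp1 : p ≤ 1)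
    (V : Matrix (Fin 2 × Fin 2) (Fin 2 × Fin 2) ℂ)
    (hV : V = ((8 * p ^ 2 / 3 : ℝ) : ℂ) • rankOne wVec
        + ((3 * (1 - p) ^ 2 / 8 : ℝ) : ℂ) • 1
        + ((2 * p * (1 - p) : ℝ) : ℂ) • (rankOne (basis2 (0, 0)) + rankOne (basis2 (1, 1)))) :
    (pt2 V).PosSemidef ↔ p ≤ 3 / 11 := by
  subst hV
  rw [pt2_rankOne_wVec_add_posSemidef_iff (by positivity) (by positivity)
    (mul_nonneg (by positivity) (sub_nonneg.2 hp1))]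
  constructor <;> intro h <;> nlinarith
end
end
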